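/- Let (R,n) be a Noetherian local ring, let 2 ≤ s ≤ t be integers, and suppose the st elements (X_{ij})_{1≤i≤s,1≤j≤t} of n form a regular sequence on R. Set A = R/I_s(X), I = LA, q = QA (with L, Q as specified). Then q ∩ I^{n+1} = q·I^n holds for all n ≥ 0. -/

import Mathlib

/-- The ideal of `R` generated by the `s × s` minors of the `s × t` matrix `X`. -/
def minorsIdeal (R : Type*) [CommRing R] {s t : ℕ} (X : Fin s → Fin t → R) : Ideal R :=
  Ideal.span {r | ∃ c : Fin s → Fin t, StrictMono c ∧
    r = Matrix.det (Matrix.of fun i j : Fin s => X i (c j))}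

/-- The ideal `L` of `R` generated by all the entries `X i j`. -/
def entriesIdeal (R : Type*) [CommRing R] {s t : ℕ} (X : Fin s → Fin t → R) : Ideal R :=
  Ideal.span {r | ∃ i j, r = X i j}

/-- The ideal `Q` of `R` generated by the `X i j` with `j − i < 0` or `j − i > t − s`,
together with the differences `X i j − X (i−1) (j−1)` for `i ≥ 1` (second row on) and
`0 ≤ j − i ≤ t − s`.  (Indices here are 0-based, so `i` ranges over `0, …, s−1` and `j`
over `0, …, t−1`; the conditions on `j − i` are the same as for the 1-based indices of
the paper.) -/
def diagIdeal (R : Type*) [CommRing R] {s t : ℕ} (X : Fin s → Fin t → R) : Ideal R :=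
  Ideal.span
    ({r | ∃ (i : Fin s) (j : Fin t), ((j : ℕ) < (i : ℕ) ∨ t - s < (j : ℕ) - (i : ℕ)) ∧
        r = X i j} ∪
     {r | ∃ (i : Fin s) (j : Fin t), 1 ≤ (i : ℕ) ∧ (i : ℕ) ≤ (j : ℕ) ∧
        (j : ℕ) - (i : ℕ) ≤ t - s ∧
        r = X i j - X ⟨(i : ℕ) - 1, Nat.lt_of_le_of_lt (Nat.sub_le _ _) i.isLt⟩
              ⟨(j : ℕ) - 1, Nat.lt_of_le_of_lt (Nat.sub_le _ _) j.isLt⟩})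

section RegularFamilies

open RingTheory.Sequence

variable {R : Type*} [CommRing R] {ι : Type*}

theorem isWeaklyRegular_self_iff (l : List R) :
    IsWeaklyRegular R l ↔ ∀ l₁ a l₂, l = l₁ ++ a :: l₂ →
      ∀ x, a * x ∈ Ideal.ofList l₁ → x ∈ Ideal.ofList l₁ := by
  simp only [isWeaklyRegular_iff, isSMulRegular_quotient_iff_mem_of_smul_mem, smul_eq_mul,
    Ideal.mul_top]
  constructor
  · rintro h l₁ a l₂ rfl x hx
    have := h l₁.length (by simp) x
    simp at this
    exact this hx
  · intro h i hi x hx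
    exact h (l.take i) l[i] (l.drop (i + 1)) (by simp) x hx

theorem ofList_map_eq_of_sub_mem {f g : ι → R} (l : List ι)
    (h : ∀ l₁ a l₂, l = l₁ ++ a :: l₂ → f a - g a ∈ Ideal.ofList (l₁.map f)) :
    Ideal.ofList (l.map f) = Ideal.ofList (l.map g) := by
  induction l using List.reverseRecOn with
  | nil => simp
  | append_singleton l a ih =>
    have ih := ih fun l₁ b l₂ hl => h l₁ b (l₂ ++ [a]) (by simp [hl])
    have ha := h l a [] rfl
    simp only [List.map_append, List.map_cons, List.map_nil, Ideal.ofList_append,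
      Ideal.ofList_singleton]
    apply le_antisymm
    · refine sup_le (ih.le.trans le_sup_left) ?_
      rw [Ideal.span_singleton_le_iff_mem, ← sub_add_cancel (f a) (g a)]
      rw [ih] at ha
      exact add_mem (Ideal.mem_sup_left ha)
        (Ideal.mem_sup_right (Ideal.mem_span_singleton_self _))
    · refine sup_le (ih.ge.trans le_sup_left) ?_
      rw [Ideal.span_singleton_le_iff_mem, ← sub_sub_cancel (f a) (g a)]
      exact sub_mem (Ideal.mem_sup_right (Ideal.mem_span_singleton_self _))
        (Ideal.mem_sup_left ha)

/-- A unitriangular change of the elements preserves weak regularity. -/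
theorem isWeaklyRegular_map_of_sub_mem {f g : ι → R} {l : List ι}
    (h : ∀ l₁ a l₂, l = l₁ ++ a :: l₂ → f a - g a ∈ Ideal.ofList (l₁.map f))
    (hf : IsWeaklyRegular R (l.map f)) : IsWeaklyRegular R (l.map g) := by
  rw [isWeaklyRegular_self_iff] at hf ⊢
  intro l₁' b l₂' hl x hx
  obtain ⟨l₁, l', rfl, rfl, hl'⟩ := List.map_eq_append_iff.1 hl
  obtain ⟨a, l₂, rfl, rfl, rfl⟩ := List.map_eq_cons_iff.1 hl'
  have e := ofList_map_eq_of_sub_mem l₁ fun k₁ b k₂ hk =>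
    h k₁ b (k₂ ++ a :: l₂) (by simp [hk])
  rw [← e] at hx ⊢
  refine hf _ (f a) (l₂.map f) (by simp) x ?_
  rw [← sub_add_cancel (f a) (g a), add_mul]
  exact add_mem (Ideal.mul_mem_right _ _ (h l₁ a l₂ rfl)) hx

/-- A family of elements which forms a regular sequence in every order. -/
def IsPermutableRegular (z : ι → R) : Prop :=
  ∀ (S : Finset ι) (i : ι), i ∉ S → ∀ a, z i * a ∈ Ideal.span (z '' S) → a ∈ Ideal.span (z '' S)

theorem isPermutableRegular_of_isWeaklyRegular [IsNoetherianRing R] [IsLocalRing R]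
    [Fintype ι] {z : ι → R} (hz : ∀ i, z i ∈ IsLocalRing.maximalIdeal R)
    {l : List ι} (hl : l.Nodup) (hmem : ∀ i, i ∈ l) (h : IsWeaklyRegular R (l.map z)) :
    IsPermutableRegular z := by
  classical
  intro S i hi a ha
  have hp : l.Perm (S.toList ++ i :: (insert i S)ᶜ.toList) := by
    rw [List.perm_ext_iff_of_nodup hl]
    · intro j
      simp only [hmem, List.mem_append, Finset.mem_toList, List.mem_cons, Finset.mem_compl,
        Finset.mem_insert]
      tauto
    · rw [List.nodup_append', List.nodup_cons]
      refine ⟨S.nodup_toList, ⟨by simp, Finset.nodup_toList _⟩, ?_⟩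
      intro j hj
      simp only [Finset.mem_toList, List.mem_cons, Finset.mem_compl, Finset.mem_insert] at hj ⊢
      rintro (rfl | h)
      · exact hi hj
      · exact h (Or.inr hj)
  have h' := IsLocalRing.isWeaklyRegular_of_perm_of_subset_maximalIdeal h (hp.map z)
    (by simp only [List.mem_map]; rintro _ ⟨j, -, rfl⟩; exact hz j)
  rw [isWeaklyRegular_self_iff] at h'
  have e : Ideal.ofList (S.toList.map z) = Ideal.span (z '' S) := by
    unfold Ideal.ofList
    congr 1
    ext; simp
  rw [← e] at ha ⊢
  exact h' _ (z i) ((insert i S)ᶜ.toList.map z) (by simp) a ha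

variable {z : ι → R}

theorem span_image_insert [DecidableEq ι] (S : Finset ι) (i : ι) :
    Ideal.span (z '' (insert i S : Finset ι)) = Ideal.span {z i} ⊔ Ideal.span (z '' S) := by
  rw [Finset.coe_insert, Set.image_insert_eq, Ideal.span_insert]

theorem sup_pow_succ_le (I J : Ideal R) (n : ℕ) :
    (I ⊔ J) ^ (n + 1) ≤ I * (I ⊔ J) ^ n ⊔ J ^ (n + 1) := by
  induction n with
  | zero => simp
  | succ n ih =>
    rw [pow_succ' _ (n + 1), Ideal.sup_mul]
    refine sup_le le_sup_left ?_
    refine (Ideal.mul_mono_right ih).trans ?_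
    rw [Ideal.mul_sup]
    refine sup_le_sup ?_ (pow_succ' J (n + 1)).ge
    rw [mul_left_comm, pow_succ' _ n]
    exact Ideal.mul_mono_right (Ideal.mul_mono_left le_sup_right)

theorem IsPermutableRegular.mem_sup_pow (h : IsPermutableRegular z) (T : Finset ι) :
    ∀ (m : ℕ) (S : Finset ι), Disjoint S T → ∀ i, i ∉ S → i ∉ T → ∀ a,
      z i * a ∈ Ideal.span (z '' S) ⊔ Ideal.span (z '' T) ^ m →
      a ∈ Ideal.span (z '' S) ⊔ Ideal.span (z '' T) ^ m := by
  classical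
  induction T using Finset.induction_on with
  | empty =>
    intro m S _ i hi _ a ha
    rcases m with _ | m
    · simp
    · simp only [Finset.coe_empty, Set.image_empty, Ideal.span_empty, ne_eq, Nat.add_eq_zero_iff,
        one_ne_zero, and_false, not_false_eq_true, ← Ideal.zero_eq_bot, zero_pow] at ha ⊢
      simp only [Ideal.zero_eq_bot, sup_bot_eq] at ha ⊢
      exact h S i hi a ha
  | insert r T hr ih =>
    intro m
    induction m with
    | zero => intros; simp
    | succ m ihm =>
      intro S hST i hiS hiT a ha
      have hdS : Disjoint S T := hST.mono_right (Finset.coe_subset.1 (by simp))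
      have hrS : r ∉ S := fun h => Finset.disjoint_left.1 hST h (by simp)
      have hiT' : i ∉ T := fun h => hiT (by simp [h])
      have hir : i ≠ r := fun h => hiT (by simp [h])
      have hmem : z r ∈ Ideal.span (z '' (insert r T : Finset ι)) :=
        Ideal.subset_span ⟨r, by simp, rfl⟩
      have hmono : Ideal.span (z '' T) ≤ Ideal.span (z '' (insert r T : Finset ι)) :=
        Ideal.span_mono (Set.image_mono (by simp))
      obtain ⟨j, hj, w, hw, hjw⟩ := Submodule.mem_sup.1 ha
      have hw' := sup_pow_succ_le (Ideal.span {z r}) (Ideal.span (z '' T)) m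
        (by rwa [← span_image_insert])
      rw [← span_image_insert] at hw'
      obtain ⟨_, hrc, b, hb, rfl⟩ := Submodule.mem_sup.1 hw'
      obtain ⟨c, hc, rfl⟩ := Ideal.mem_span_singleton_mul.1 hrc
      have hc' := ih (m + 1) (insert i S) (by simp [hdS, hiT']) r
        (by simp [hrS, hir.symm]) hr c (by
          rw [span_image_insert]
          have : z r * c = (z i * a - j) - b := by rw [← hjw]; ring
          rw [this]
          refine sub_mem (Ideal.mem_sup_left (sub_mem ?_ ?_)) (Ideal.mem_sup_right hb)
          · exact Ideal.mem_sup_left (Ideal.mul_mem_right _ _ (Ideal.mem_span_singleton_self _))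
          · exact Ideal.mem_sup_right hj)
      rw [span_image_insert] at hc'
      obtain ⟨k, hk, e, he, rfl⟩ := Submodule.mem_sup.1 hc'
      obtain ⟨u, hu, j', hj', rfl⟩ := Submodule.mem_sup.1 hk
      obtain ⟨d, rfl⟩ := Ideal.mem_span_singleton'.1 hu
      have h1 : a - z r * d ∈ Ideal.span (z '' S) ⊔ Ideal.span (z '' T) ^ (m + 1) := by
        refine ih (m + 1) S hdS i hiS hiT' _ ?_
        have : z i * (a - z r * d) = (j + z r * j') + (b + z r * e) := by
          rw [mul_sub, ← hjw]; ring
        rw [this]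
        exact add_mem (Ideal.mem_sup_left (add_mem hj (Ideal.mul_mem_left _ _ hj')))
          (Ideal.mem_sup_right (add_mem hb (Ideal.mul_mem_left _ _ he)))
      have h2 : d ∈ Ideal.span (z '' S) ⊔ Ideal.span (z '' (insert r T : Finset ι)) ^ m := by
        refine ihm S hST i hiS hiT d ?_
        have : z i * d = (d * z i + j' + e) - e - j' := by ring
        rw [this]
        exact sub_mem (sub_mem (Ideal.mem_sup_right hc) (Ideal.mem_sup_right
          (Ideal.pow_right_mono hmono _ (Ideal.pow_le_pow_right (Nat.le_succ m) he))))
          (Ideal.mem_sup_left hj')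
      rw [← sub_add_cancel a (z r * d)]
      refine add_mem (sup_le_sup_left (Ideal.pow_right_mono hmono _) _ h1) ?_
      obtain ⟨v, hv, v', hv', rfl⟩ := Submodule.mem_sup.1 h2
      rw [mul_add]
      refine add_mem (Ideal.mem_sup_left (Ideal.mul_mem_left _ _ hv)) (Ideal.mem_sup_right ?_)
      rw [pow_succ']
      exact Ideal.mul_mem_mul hmem hv'

theorem IsPermutableRegular.span_inf_pow_le (h : IsPermutableRegular z) (T : Finset ι) (m : ℕ)
    (S : Finset ι) (hST : Disjoint S T) :
    Ideal.span (z '' S) ⊓ Ideal.span (z '' T) ^ m ≤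
      Ideal.span (z '' S) * Ideal.span (z '' T) ^ m := by
  classical
  induction S using Finset.induction_on with
  | empty => simp
  | insert i S hi ih =>
    rw [Finset.disjoint_insert_left] at hST
    rintro a ⟨ha, haT⟩
    rw [SetLike.mem_coe, span_image_insert] at ha
    obtain ⟨u, hu, b, hb, rfl⟩ := Submodule.mem_sup.1 ha
    obtain ⟨c, rfl⟩ := Ideal.mem_span_singleton'.1 hu
    have hc := h.mem_sup_pow T m S hST.2 i hi hST.1 c (by
      rw [← add_sub_cancel_right (z i * c) b, mul_comm]
      exact sub_mem (Ideal.mem_sup_right haT) (Ideal.mem_sup_left hb))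
    obtain ⟨e, he, p, hp, rfl⟩ := Submodule.mem_sup.1 hc
    have hpi : z i * p ∈ Ideal.span (z '' T) ^ m := Ideal.mul_mem_left _ _ hp
    have h1 : e * z i + b ∈ Ideal.span (z '' S) * Ideal.span (z '' T) ^ m := by
      refine ih hST.2 ⟨add_mem (Ideal.mul_mem_right _ _ he) hb, ?_⟩
      have : e * z i + b = ((e + p) * z i + b) - z i * p := by ring
      rw [this]
      exact sub_mem haT hpi
    have : (e + p) * z i + b = z i * p + (e * z i + b) := by ring
    rw [this, span_image_insert, Ideal.sup_mul]
    exact add_mem (Ideal.mem_sup_left (Ideal.mul_mem_mul (Ideal.mem_span_singleton_self _) hp))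
      (Ideal.mem_sup_right h1)

theorem IsPermutableRegular.span_inf_sup_pow_le (h : IsPermutableRegular z) {S T : Finset ι}
    (hST : Disjoint S T) (n : ℕ) :
    Ideal.span (z '' S) ⊓ (Ideal.span (z '' S) ⊔ Ideal.span (z '' T)) ^ (n + 1) ≤
      Ideal.span (z '' S) * (Ideal.span (z '' S) ⊔ Ideal.span (z '' T)) ^ n := by
  rintro a ⟨haS, ha⟩
  have hle := h.span_inf_pow_le T (n + 1) S hST
  generalize Ideal.span (z '' (S : Set ι)) = I at *
  generalize Ideal.span (z '' (T : Set ι)) = J at *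
  obtain ⟨u, hu, v, hv, huv⟩ := Submodule.mem_sup.1 (sup_pow_succ_le I J n ha)
  have hvI : v ∈ I := by
    rw [← add_sub_cancel_left u v, huv]
    exact sub_mem haS (Ideal.mul_le_left hu)
  have hJ : J ^ (n + 1) ≤ (I ⊔ J) ^ n :=
    (Ideal.pow_le_pow_right n.le_succ).trans (Ideal.pow_right_mono le_sup_right n)
  rw [← huv]
  exact add_mem hu (Ideal.mul_mono_right hJ (hle ⟨hvI, hv⟩))

end RegularFamilies

section ToeplitzMinors

theorem sum_sq_sub_lt_sum_sq_sub_perm {s : ℕ} {c : Fin s → ℕ} (hc : StrictMono c)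
    {σ : Equiv.Perm (Fin s)} (hσ : σ ≠ 1) :
    ∑ i, ((c i : ℤ) - (i : ℕ)) ^ 2 < ∑ i, ((c i : ℤ) - (σ i : ℕ)) ^ 2 := by
  have hmono : Monovary (fun i => (c i : ℤ)) (fun i : Fin s => ((i : ℕ) : ℤ)) := by
    intro i j hij
    exact Int.ofNat_le.2 (hc.monotone (Int.ofNat_lt.1 hij).le)
  have hlt := (hmono.sum_mul_comp_perm_lt_sum_mul_iff (σ := σ)).2 (by
    intro h
    apply hσ
    have hinv : Monotone (σ⁻¹ : Equiv.Perm (Fin s)) := by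
      intro a b hab
      rcases hab.eq_or_lt with rfl | hab
      · rfl
      · exact hc.le_iff_le.1 (Int.ofNat_le.1 (@h (σ⁻¹ a) (σ⁻¹ b) (by simpa using hab)))
    exact inv_eq_one.1 ((Equiv.Perm.monotone_iff _).1 hinv))
  have hperm : ∑ i, ((σ i : ℕ) : ℤ) ^ 2 = ∑ i : Fin s, ((i : ℕ) : ℤ) ^ 2 :=
    Equiv.sum_comp σ fun i : Fin s => ((i : ℕ) : ℤ) ^ 2
  have e : ∀ τ : Fin s → Fin s, ∑ i, ((c i : ℤ) - (τ i : ℕ)) ^ 2 =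
      ∑ i, (c i : ℤ) ^ 2 - 2 * ∑ i, (c i : ℤ) * (τ i : ℕ) + ∑ i, ((τ i : ℕ) : ℤ) ^ 2 := by
    intro τ
    rw [Finset.mul_sum, ← Finset.sum_sub_distrib, ← Finset.sum_add_distrib]
    exact Finset.sum_congr rfl fun i _ => by ring
  have e1 := e id
  have e2 := e σ
  simp only [id] at e1
  rw [e1, e2, hperm]
  linarith

variable {R : Type*} [CommRing R]

/-- The entry in row `i` and column `k` of the Toeplitz band matrix on `Y 0, …, Y m`. -/
def toeplitzBand (Y : ℕ → R) (m i k : ℕ) : R :=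
  if i ≤ k ∧ k - i ≤ m then Y (k - i) else 0

theorem prod_mem_of_toeplitzBand_det_mem (Y : ℕ → R) (s m : ℕ) (J : Ideal R)
    (hJ : ∀ c : Fin s → ℕ, StrictMono c → (∀ i, c i < s + m) →
      (Matrix.of fun i j : Fin s => toeplitzBand Y m i (c j)).det ∈ J)
    (a : Fin s → ℕ) (ha : ∀ i, a i ≤ m) : ∏ i, Y (a i) ∈ J := by
  have key : ∀ (N : ℕ) (a : Fin s → ℕ), (∀ i, a i ≤ m) → s * m ^ 2 ≤ ∑ i, a i ^ 2 + N →
      ∏ i, Y (a i) ∈ J := by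
    intro N
    induction N using Nat.strong_induction_on with
    | _ N ih =>
      have sorted : ∀ a : Fin s → ℕ, Monotone a → (∀ i, a i ≤ m) →
          s * m ^ 2 ≤ ∑ i, a i ^ 2 + N → ∏ i, Y (a i) ∈ J := by
        intro a hmono ha hN
        have hc : StrictMono fun i : Fin s => a i + i := fun i j hij =>
          Nat.add_lt_add_of_le_of_lt (hmono hij.le) hij
        have hdet := hJ _ hc fun i => by have := ha i; omega
        rw [Matrix.det_apply, ← Finset.add_sum_erase _ _ (Finset.mem_univ 1)] at hdet
        simp only [Equiv.Perm.sign_one, one_smul, Matrix.of_apply, Equiv.Perm.coe_one, id] at hdet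
        have hdiag : ∏ i : Fin s, toeplitzBand Y m i (a i + i) = ∏ i, Y (a i) :=
          Finset.prod_congr rfl fun i _ => by simp [toeplitzBand, ha i]
        rw [hdiag] at hdet
        refine (Ideal.add_mem_iff_left _ (sum_mem fun σ hσ => ?_)).1 hdet
        rw [Units.smul_def, zsmul_eq_mul]
        refine Ideal.mul_mem_left _ _ ?_
        by_cases hb : ∀ i, (σ i : ℕ) ≤ a i + i ∧ a i + i - σ i ≤ m
        · have hprod : ∏ i : Fin s, toeplitzBand Y m (σ i) (a i + i) =
              ∏ i, Y (a i + i - σ i) :=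
            Finset.prod_congr rfl fun i _ => by simp only [toeplitzBand]; rw [if_pos (hb i)]
          rw [hprod]
          have hlt := sum_sq_sub_lt_sum_sq_sub_perm hc (Finset.ne_of_mem_erase hσ)
          have hlt' : ∑ i, a i ^ 2 < ∑ i, (a i + i - σ i) ^ 2 := by
            zify
            convert hlt using 3 with i _ i _
            · push_cast; ring
            · rw [Nat.cast_sub (hb i).1]
          have hle : ∑ i, (a i + i - σ i) ^ 2 ≤ s * m ^ 2 := by
            refine (Finset.sum_le_card_nsmul _ _ (m ^ 2) fun i _ =>
              Nat.pow_le_pow_left (hb i).2 2).trans (by simp)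
          exact ih (s * m ^ 2 - ∑ i, (a i + i - σ i) ^ 2) (by omega) _ (fun i => (hb i).2)
            (by omega)
        · push Not at hb
          obtain ⟨i, hi⟩ := hb
          rw [Finset.prod_eq_zero (Finset.mem_univ i)]
          · exact zero_mem _
          · simp only [toeplitzBand, ite_eq_right_iff, and_imp]
            exact fun h1 h2 => absurd h2 (not_le.2 (hi h1))
      intro a ha hN
      rw [← Equiv.prod_comp (Tuple.sort a) fun i => Y (a i)]
      refine sorted (a ∘ Tuple.sort a) (Tuple.monotone_sort a) (fun i => ha _) ?_
      rwa [← Equiv.sum_comp (Tuple.sort a) fun i => a i ^ 2] at hN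
  exact key (s * m ^ 2) a ha (Nat.le_add_left _ _)

/-- An ideal containing the maximal minors of the `s`-rowed Toeplitz band matrix contains the
`s`-th power of the ideal generated by its entries. -/
theorem span_pow_le_of_toeplitzBand_det_mem (Y : ℕ → R) (s m : ℕ) (J : Ideal R)
    (hJ : ∀ c : Fin s → ℕ, StrictMono c → (∀ i, c i < s + m) →
      (Matrix.of fun i j : Fin s => toeplitzBand Y m i (c j)).det ∈ J) :
    Ideal.span (Y '' Set.Iic m) ^ s ≤ J := by
  rw [Ideal.span, Submodule.span_pow, Submodule.span_le]
  intro r hr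
  obtain ⟨f, rfl⟩ := Set.mem_pow.1 hr
  choose a ha hYa using fun i => (f i).2
  rw [List.prod_ofFn]
  simp only [← hYa]
  exact prod_mem_of_toeplitzBand_det_mem Y s m J hJ a ha

theorem prod_sub_prod_mem {κ : Type*} {I L : Ideal R} (hIL : I ≤ L) {f g : κ → R}
    (hf : ∀ i, f i ∈ L) (hfg : ∀ i, f i - g i ∈ I) (F : Finset κ) (n : ℕ)
    (hF : F.card = n + 1) : ∏ i ∈ F, f i - ∏ i ∈ F, g i ∈ I * L ^ n := by
  classical
  have hg : ∀ i, g i ∈ L := fun i => by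
    rw [← sub_sub_cancel (f i) (g i)]
    exact sub_mem (hf i) (hIL (hfg i))
  induction n generalizing F with
  | zero =>
    obtain ⟨i, rfl⟩ := Finset.card_eq_one.1 hF
    simpa using hfg i
  | succ n ih =>
    obtain ⟨i, F, hi, rfl, hF'⟩ := Finset.card_eq_succ.1 hF
    have e : ∏ j ∈ insert i F, f j - ∏ j ∈ insert i F, g j =
        (f i - g i) * ∏ j ∈ F, f j + g i * (∏ j ∈ F, f j - ∏ j ∈ F, g j) := by
      rw [Finset.prod_insert hi, Finset.prod_insert hi]; ring
    rw [e]
    refine add_mem (Ideal.mul_mem_mul (hfg i) ?_) ?_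
    · rw [← hF', ← Finset.prod_const]
      exact Ideal.prod_mem_prod fun j _ => hf j
    · rw [pow_succ', mul_left_comm]
      exact Ideal.mul_mem_mul (hg i) (ih F hF')

end ToeplitzMinors

section GenericMatrix

variable {R : Type*} [CommRing R] {s t : ℕ} (X : Fin s → Fin t → R)

theorem mem_entriesIdeal (i : Fin s) (j : Fin t) : X i j ∈ entriesIdeal R X :=
  Ideal.subset_span ⟨i, j, rfl⟩

theorem diagIdeal_le_entriesIdeal : diagIdeal R X ≤ entriesIdeal R X := by
  refine Ideal.span_le.2 ?_
  rintro _ (⟨i, j, -, rfl⟩ | ⟨i, j, -, -, -, rfl⟩)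
  · exact mem_entriesIdeal X _ _
  · exact sub_mem (mem_entriesIdeal X _ _) (mem_entriesIdeal X _ _)

theorem minorsIdeal_le_entriesIdeal_pow : minorsIdeal R X ≤ entriesIdeal R X ^ s := by
  refine Ideal.span_le.2 ?_
  rintro _ ⟨c, -, rfl⟩
  rw [SetLike.mem_coe, Matrix.det_apply]
  refine sum_mem fun σ _ => ?_
  rw [Units.smul_def, zsmul_eq_mul]
  refine Ideal.mul_mem_left _ _ ?_
  have h : ∏ i, X (σ i) (c i) ∈ ∏ _i : Fin s, entriesIdeal R X :=
    Ideal.prod_mem_prod fun i _ => mem_entriesIdeal X _ _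
  simpa using h

/-- The first row of `X`, extended by zero. -/
def firstRow (k : ℕ) : R :=
  if h : 0 < s ∧ k < t then X ⟨0, h.1⟩ ⟨k, h.2⟩ else 0

theorem firstRow_mem_entriesIdeal (k : ℕ) : firstRow X k ∈ entriesIdeal R X := by
  unfold firstRow
  split
  · exact mem_entriesIdeal X _ _
  · exact zero_mem _

theorem sub_toeplitzBand_mem_diagIdeal (i : Fin s) (j : Fin t) :
    X i j - toeplitzBand (firstRow X) (t - s) i j ∈ diagIdeal R X := by
  obtain ⟨i, hi⟩ := i
  induction i generalizing j with
  | zero =>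
    by_cases h : (j : ℕ) ≤ t - s
    · simp [toeplitzBand, firstRow, h, hi]
    · simp only [toeplitzBand, Nat.sub_zero, Nat.zero_le, true_and, if_neg h, sub_zero]
      exact Ideal.subset_span (Or.inl ⟨_, _, Or.inr (by simpa using h), rfl⟩)
  | succ i ih =>
    by_cases h : i + 1 ≤ (j : ℕ) ∧ (j : ℕ) - (i + 1) ≤ t - s
    · have hprev := ih ⟨(j : ℕ) - 1, by omega⟩ (by omega)
      have hstep : X ⟨i + 1, hi⟩ j - X ⟨i, by omega⟩ ⟨(j : ℕ) - 1, by omega⟩ ∈ diagIdeal R X :=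
        Ideal.subset_span (Or.inr ⟨⟨i + 1, hi⟩, j, by simp, h.1, h.2, rfl⟩)
      have e : toeplitzBand (firstRow X) (t - s) (i + 1) j =
          toeplitzBand (firstRow X) (t - s) i (j - 1) := by
        unfold toeplitzBand
        rw [if_pos h, if_pos (by omega)]
        congr 1
        omega
      simp only [e]
      simpa using add_mem hstep hprev
    · simp only [toeplitzBand, if_neg h, sub_zero]
      refine Ideal.subset_span (Or.inl ⟨_, _, ?_, rfl⟩)
      simp only
      omega

theorem entriesIdeal_eq_sup : entriesIdeal R X =
    diagIdeal R X ⊔ Ideal.span (firstRow X '' Set.Iic (t - s)) := by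
  apply le_antisymm
  · refine Ideal.span_le.2 ?_
    rintro _ ⟨i, j, rfl⟩
    rw [SetLike.mem_coe, ← sub_add_cancel (X i j) (toeplitzBand (firstRow X) (t - s) i j)]
    refine add_mem (Ideal.mem_sup_left (sub_toeplitzBand_mem_diagIdeal X i j))
      (Ideal.mem_sup_right ?_)
    unfold toeplitzBand
    split_ifs with h
    · exact Ideal.subset_span ⟨_, h.2, rfl⟩
    · exact zero_mem _
  · refine sup_le (diagIdeal_le_entriesIdeal X) (Ideal.span_le.2 ?_)
    rintro _ ⟨k, -, rfl⟩
    exact firstRow_mem_entriesIdeal X k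

theorem entriesIdeal_pow_le {n : ℕ} {X : Fin (n + 1) → Fin t → R} (hst : n + 1 ≤ t) :
    entriesIdeal R X ^ (n + 1) ≤
      minorsIdeal R X ⊔ diagIdeal R X * entriesIdeal R X ^ n := by
  have h := sup_pow_succ_le (diagIdeal R X)
    (Ideal.span (firstRow X '' Set.Iic (t - (n + 1)))) n
  rw [← entriesIdeal_eq_sup] at h
  refine h.trans (sup_le le_sup_right ?_)
  refine span_pow_le_of_toeplitzBand_det_mem _ _ _ _ fun c hc hct => ?_
  let c' : Fin (n + 1) → Fin t := fun i => ⟨c i, by have := hct i; omega⟩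
  have hX : (Matrix.of fun i j : Fin (n + 1) => X i (c' j)).det ∈ minorsIdeal R X :=
    Ideal.subset_span ⟨c', fun i j hij => hc hij, rfl⟩
  rw [← sub_sub_cancel (Matrix.det (Matrix.of fun i j : Fin (n + 1) => X i (c' j)))
    (Matrix.det _)]
  refine sub_mem (Ideal.mem_sup_left hX) (Ideal.mem_sup_right ?_)
  rw [Matrix.det_apply, Matrix.det_apply, ← Finset.sum_sub_distrib]
  refine sum_mem fun σ _ => ?_
  rw [← smul_sub, Units.smul_def, zsmul_eq_mul]
  refine Ideal.mul_mem_left _ _ ?_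
  exact prod_sub_prod_mem (diagIdeal_le_entriesIdeal X) (fun i => mem_entriesIdeal X _ _)
    (fun i => sub_toeplitzBand_mem_diagIdeal X (σ i) (c' i)) _ n (by simp)

/-- The entries of `X`, with each band entry below the first row replaced by its difference with
the previous entry on its diagonal. -/
def diagDifference (p : Fin s × Fin t) : R :=
  if 1 ≤ (p.1 : ℕ) ∧ (p.1 : ℕ) ≤ p.2 ∧ (p.2 : ℕ) - p.1 ≤ t - s then
    X p.1 p.2 - X ⟨(p.1 : ℕ) - 1, Nat.lt_of_le_of_lt (Nat.sub_le _ _) p.1.isLt⟩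
      ⟨(p.2 : ℕ) - 1, Nat.lt_of_le_of_lt (Nat.sub_le _ _) p.2.isLt⟩
  else X p.1 p.2

theorem diagIdeal_eq_span : diagIdeal R X = Ideal.span (diagDifference X ''
    (Finset.univ.filter fun p : Fin s × Fin t => ¬ ((p.1 : ℕ) = 0 ∧ (p.2 : ℕ) ≤ t - s) :
      Finset (Fin s × Fin t))) := by
  unfold diagIdeal
  congr 1
  ext r
  simp only [Set.mem_union, Set.mem_ofPred_eq, Finset.coe_filter, Finset.mem_univ, true_and,
    Set.mem_image, Prod.exists]
  constructor
  · rintro (⟨i, j, h, rfl⟩ | ⟨i, j, h1, h2, h3, rfl⟩)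
    · refine ⟨i, j, by omega, ?_⟩
      rw [diagDifference, if_neg (by simp only; omega)]
    · refine ⟨i, j, by omega, ?_⟩
      rw [diagDifference, if_pos ⟨h1, h2, h3⟩]
  · rintro ⟨i, j, h, rfl⟩
    unfold diagDifference
    split_ifs with hb
    · exact Or.inr ⟨i, j, hb.1, hb.2.1, hb.2.2, rfl⟩
    · exact Or.inl ⟨i, j, by simp only at hb; omega, rfl⟩

theorem span_firstRow_eq_span (hs : 0 < s) (hst : s ≤ t) :
    Ideal.span (firstRow X '' Set.Iic (t - s)) = Ideal.span (diagDifference X ''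
    (Finset.univ.filter fun p : Fin s × Fin t => (p.1 : ℕ) = 0 ∧ (p.2 : ℕ) ≤ t - s :
      Finset (Fin s × Fin t))) := by
  congr 1
  ext r
  simp only [Finset.coe_filter, Finset.mem_univ, true_and, Set.mem_image, Set.mem_Iic,
    Set.mem_ofPred_eq, Prod.exists]
  constructor
  · rintro ⟨k, hk, rfl⟩
    have hkt : k < t := by omega
    exact ⟨⟨0, hs⟩, ⟨k, hkt⟩, ⟨rfl, hk⟩, by simp [diagDifference, firstRow, hs, hkt]⟩
  · rintro ⟨⟨i, hi⟩, j, ⟨h0, hj⟩, rfl⟩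
    simp only at h0
    subst h0
    exact ⟨j, hj, by simp [diagDifference, firstRow, hs]⟩

/-- The indices of an `s × t` matrix, listed row by row. -/
def rowMajor (s t : ℕ) : List (Fin s × Fin t) :=
  (List.finRange s).flatMap fun i => (List.finRange t).map (Prod.mk i)

theorem mem_rowMajor (p : Fin s × Fin t) : p ∈ rowMajor s t := by
  simp [rowMajor]

theorem nodup_rowMajor : (rowMajor s t).Nodup := by
  refine List.nodup_flatMap.2 ⟨fun i _ => (List.nodup_finRange t).map (Prod.mk_right_injective i),
    (List.nodup_finRange s).imp fun hij p hp hp' => hij ?_⟩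
  obtain ⟨_, -, rfl⟩ := List.mem_map.1 hp
  obtain ⟨_, -, h⟩ := List.mem_map.1 hp'
  exact (congrArg Prod.fst h).symm

theorem pairwise_rowMajor : (rowMajor s t).Pairwise fun p q => p.1 ≤ q.1 := by
  refine List.pairwise_flatMap.2 ⟨fun i _ => ?_, ?_⟩
  · rw [List.pairwise_map]
    exact List.pairwise_of_forall fun _ _ => le_rfl
  · refine (List.pairwise_lt_finRange s).imp fun hij p hp q hq => ?_
    obtain ⟨_, -, rfl⟩ := List.mem_map.1 hp
    obtain ⟨_, -, rfl⟩ := List.mem_map.1 hq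
    exact hij.le

theorem mem_of_rowMajor_eq {l₁ l₂ : List (Fin s × Fin t)} {p q : Fin s × Fin t}
    (h : rowMajor s t = l₁ ++ p :: l₂) (hq : q.1 < p.1) : q ∈ l₁ := by
  have hmem := mem_rowMajor q
  have hpw := pairwise_rowMajor (s := s) (t := t)
  rw [h] at hmem hpw
  rcases List.mem_append.1 hmem with hq' | hq'
  · exact hq'
  · exfalso
    rcases List.mem_cons.1 hq' with rfl | hq'
    · exact lt_irrefl _ hq
    · exact not_lt.2 ((List.pairwise_cons.1 (List.pairwise_append.1 hpw).2.1).1 q hq') hq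

theorem isPermutableRegular_diagDifference [IsNoetherianRing R] [IsLocalRing R]
    (hmem : ∀ i j, X i j ∈ IsLocalRing.maximalIdeal R)
    (hreg : RingTheory.Sequence.IsWeaklyRegular R
      ((List.finRange s).flatMap (fun i => (List.finRange t).map (X i)))) :
    IsPermutableRegular (diagDifference X) := by
  refine isPermutableRegular_of_isWeaklyRegular ?_ nodup_rowMajor mem_rowMajor
    (isWeaklyRegular_map_of_sub_mem (f := fun p : Fin s × Fin t => X p.1 p.2) ?_ ?_)
  · intro p
    unfold diagDifference
    split_ifs
    · exact sub_mem (hmem _ _) (hmem _ _)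
    · exact hmem _ _
  · intro l₁ p l₂ h
    unfold diagDifference
    split_ifs with hb
    · rw [sub_sub_cancel]
      refine Ideal.subset_span (List.mem_map.2 ⟨(_, _), mem_of_rowMajor_eq h ?_, rfl⟩)
      rw [Fin.lt_def]
      simp only
      omega
    · simp
  · simpa [rowMajor, List.map_flatMap, Function.comp_def] using hreg

theorem diagIdeal_inf_pow_le [IsNoetherianRing R] [IsLocalRing R] (hs : 0 < s) (hst : s ≤ t)
    (hmem : ∀ i j, X i j ∈ IsLocalRing.maximalIdeal R)
    (hreg : RingTheory.Sequence.IsWeaklyRegular R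
      ((List.finRange s).flatMap (fun i => (List.finRange t).map (X i)))) (n : ℕ) :
    diagIdeal R X ⊓ entriesIdeal R X ^ (n + 1) ≤ diagIdeal R X * entriesIdeal R X ^ n := by
  rw [entriesIdeal_eq_sup, span_firstRow_eq_span X hs hst, diagIdeal_eq_span X]
  exact (isPermutableRegular_diagDifference X hmem hreg).span_inf_sup_pow_le
    (Finset.disjoint_filter_filter_not _ _ _).symm n

theorem sup_inf_entriesIdeal_pow_le [IsNoetherianRing R] [IsLocalRing R]
    (hs : 0 < s) (hst : s ≤ t)
    (hmem : ∀ i j, X i j ∈ IsLocalRing.maximalIdeal R)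
    (hreg : RingTheory.Sequence.IsWeaklyRegular R
      ((List.finRange s).flatMap (fun i => (List.finRange t).map (X i)))) (n : ℕ) :
    (diagIdeal R X ⊔ minorsIdeal R X) ⊓ entriesIdeal R X ^ (n + 1) ≤
      diagIdeal R X * entriesIdeal R X ^ n ⊔ minorsIdeal R X := by
  have hpow : ∀ k, entriesIdeal R X ^ (s + k) ≤
      diagIdeal R X * entriesIdeal R X ^ (s - 1 + k) ⊔ minorsIdeal R X := by
    intro k
    obtain ⟨m, rfl⟩ := Nat.exists_eq_succ_of_ne_zero hs.ne'
    rw [pow_add]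
    refine (Ideal.mul_mono_left (entriesIdeal_pow_le hst)).trans ?_
    rw [Ideal.sup_mul, sup_comm, mul_assoc, ← pow_add]
    exact sup_le_sup le_rfl Ideal.mul_le_left
  rcases le_or_gt s (n + 1) with h | h
  · have := hpow (n + 1 - s)
    rw [show s + (n + 1 - s) = n + 1 by omega, show s - 1 + (n + 1 - s) = n by omega] at this
    exact inf_le_right.trans this
  · rintro x ⟨hx, hxn⟩
    obtain ⟨y, hy, d, hd, rfl⟩ := Submodule.mem_sup.1 hx
    refine add_mem (Ideal.mem_sup_left ?_) (Ideal.mem_sup_right hd)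
    refine diagIdeal_inf_pow_le X hs hst hmem hreg n ⟨hy, ?_⟩
    rw [← add_sub_cancel_right y d]
    exact sub_mem hxn (Ideal.pow_le_pow_right h.le (minorsIdeal_le_entriesIdeal_pow X hd))

end GenericMatrix

theorem stmt_9
    (R : Type*) [CommRing R] [IsNoetherianRing R] [IsLocalRing R]
    (s t : ℕ) (hs : 2 ≤ s) (hst : s ≤ t)
    (X : Fin s → Fin t → R)
    -- the st entries X i j lie in the maximal ideal and form a regular sequence on R
    (hmem : ∀ i j, X i j ∈ IsLocalRing.maximalIdeal R)
    (hreg : RingTheory.Sequence.IsRegular R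
      ((List.finRange s).flatMap (fun i => (List.finRange t).map (X i))))
    -- I = LA and q = QA are the images of L and Q in A = R/I_s(X)
    (I : Ideal (R ⧸ minorsIdeal R X))
    (hI : I = (entriesIdeal R X).map (Ideal.Quotient.mk (minorsIdeal R X)))
    (q : Ideal (R ⧸ minorsIdeal R X))
    (hq : q = (diagIdeal R X).map (Ideal.Quotient.mk (minorsIdeal R X))) :
    ∀ n : ℕ, q ⊓ I ^ (n + 1) = q * I ^ n := by
  intro n
  subst hI hq
  apply le_antisymm
  · rw [← Ideal.map_pow, ← Ideal.map_pow, ← Ideal.map_mul]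
    rintro a ⟨haq, haI⟩
    obtain ⟨x, hx, rfl⟩ :=
      (Ideal.mem_map_iff_of_surjective _ Ideal.Quotient.mk_surjective).1 haI
    rw [SetLike.mem_coe, Ideal.mem_quotient_iff_mem_sup] at haq
    rw [Ideal.mem_quotient_iff_mem_sup]
    exact sup_inf_entriesIdeal_pow_le X (by omega) hst hmem hreg.toIsWeaklyRegular n ⟨haq, hx⟩
  · rw [pow_succ']
    exact le_inf Ideal.mul_le_left
      (Ideal.mul_mono_left (Ideal.map_mono (diagIdeal_le_entriesIdeal X)))
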